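/- arXiv:2111.05774 — 7 statements merged into one kernel-verified Lean document; each statement's English description precedes it below -/
import Mathlib

section
/- Let K be a finite simplicial complex and L ⊆ K a subcomplex such that K collapses to L via a sequence of elementary collapses removing the pairs (σ₁,τ₁), (σ₂,τ₂), …, (σₙ,τₙ). Then M = {(σ₁,τ₁),…,(σₙ,τₙ)} is a Morse matching on K whose matched (non-critical) simplices are exactly the simplices of K ∖ L. -/
variable {V : Type*} [DecidableEq V]

/-- `σ` is a facet (codimension-one face) of `τ`. -/
def Facet (σ τ : Finset V) : Prop := σ ⊆ τ ∧ τ.card = σ.card + 1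

/-- A finite abstract simplicial complex: a finite family of nonempty finite sets,
closed under taking nonempty subsets. -/
def IsComplex (K : Finset (Finset V)) : Prop :=
  (∀ σ ∈ K, σ.Nonempty) ∧ ∀ σ ∈ K, ∀ τ, τ ⊆ σ → τ.Nonempty → τ ∈ K

/-- A partial matching on the complex `K`: a set of pairs `(σ, τ)` with `σ ≺ τ`,
such that every simplex belongs to at most one pair. -/
def IsMatching (K : Finset (Finset V)) (M : Finset (Finset V × Finset V)) : Prop :=
  (∀ p ∈ M, p.1 ∈ K ∧ p.2 ∈ K ∧ Facet p.1 p.2) ∧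
  ∀ p ∈ M, ∀ q ∈ M, (p.1 = q.1 ∨ p.1 = q.2 ∨ p.2 = q.1 ∨ p.2 = q.2) → p = q

/-- Acyclicity of a matching: there is no cycle
`a₀ ≺ b₀ ≻ a₁ ≺ b₁ ≻ ⋯ ≺ b_{n-1} ≻ a₀` with `n ≥ 2`, all `(aᵢ, bᵢ) ∈ M`
and all `bᵢ` distinct. -/
def IsAcyclicMatching (M : Finset (Finset V × Finset V)) : Prop :=
  ¬ ∃ (n : ℕ) (a b : ℕ → Finset V), 2 ≤ n ∧
      (∀ i < n, ∀ j < n, b i = b j → i = j) ∧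
      (∀ i < n, (a i, b i) ∈ M) ∧
      (∀ i < n, Facet (a ((i + 1) % n)) (b i))

/-- A Morse matching on `K` is an acyclic partial matching. -/
def MorseMatching (K : Finset (Finset V)) (M : Finset (Finset V × Finset V)) : Prop :=
  IsMatching K M ∧ IsAcyclicMatching M

/-- A simplex is critical for `M` if it belongs to no pair of `M`. -/
def IsCritical (M : Finset (Finset V × Finset V)) (σ : Finset V) : Prop :=
  ∀ p ∈ M, σ ≠ p.1 ∧ σ ≠ p.2

/-- The number of critical simplices of dimension `i` (i.e. cardinality `i + 1`). -/
noncomputable def critCount (K : Finset (Finset V)) (M : Finset (Finset V × Finset V)) (i : ℕ) : ℕ :=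
  {σ : Finset V | σ ∈ K ∧ σ.card = i + 1 ∧ IsCritical M σ}.ncard

/-- The total number of critical simplices. -/
noncomputable def totalCrit (K : Finset (Finset V)) (M : Finset (Finset V × Finset V)) : ℕ :=
  {σ : Finset V | σ ∈ K ∧ IsCritical M σ}.ncard

/-- `σ` is a free face of `K` with unique proper coface `τ`. -/
def IsFreePair (K : Finset (Finset V)) (σ τ : Finset V) : Prop :=
  σ ∈ K ∧ τ ∈ K ∧ σ ⊂ τ ∧ ∀ ρ ∈ K, σ ⊂ ρ → ρ = τ

/-- An elementary collapse removes a free pair `{σ, τ}` from `K`. -/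
def ElemCollapse (K K' : Finset (Finset V)) : Prop :=
  ∃ σ τ : Finset V, IsFreePair K σ τ ∧ K' = K \ {σ, τ}

/-- `K` collapses to `L` via a finite sequence of elementary collapses. -/
def Collapses (K L : Finset (Finset V)) : Prop :=
  Relation.ReflTransGen ElemCollapse K L

/-- `K` is collapsible if it collapses to a single vertex. -/
def Collapsible (K : Finset (Finset V)) : Prop :=
  ∃ v : V, Collapses K {{v}}

/-- The 1-skeleton of `K` is a connected graph. -/
def SkeletonConnected (K : Finset (Finset V)) : Prop :=
  ∀ u v : V, ({u} : Finset V) ∈ K → ({v} : Finset V) ∈ K →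
    Relation.ReflTransGen (fun a b => a ≠ b ∧ ({a, b} : Finset V) ∈ K) u v

/-- `CollapseAlong K ps L`: `K` collapses to `L` by the sequence of elementary
collapses removing, in order, the free pairs listed in `ps`. -/
inductive CollapseAlong :
    Finset (Finset V) → List (Finset V × Finset V) → Finset (Finset V) → Prop
  | nil (K : Finset (Finset V)) : CollapseAlong K [] K
  | cons {K L : Finset (Finset V)} {p : Finset V × Finset V} {l : List (Finset V × Finset V)}
      (hfree : IsFreePair K p.1 p.2) (htail : CollapseAlong (K \ {p.1, p.2}) l L) :
      CollapseAlong K (p :: l) L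

theorem IsFreePair.facet {K : Finset (Finset V)} (hK : IsComplex K) {σ τ : Finset V}
    (h : IsFreePair K σ τ) : Facet σ τ := by
  obtain ⟨-, hτ, hστ, huniq⟩ := h
  obtain ⟨x, hxτ, hxσ⟩ := Finset.exists_of_ssubset hστ
  have hins : insert x σ = τ :=
    huniq _ (hK.2 τ hτ _ (Finset.insert_subset hxτ hστ.1) (Finset.insert_nonempty x σ))
      (Finset.ssubset_insert hxσ)
  exact ⟨hστ.1, by rw [← hins, Finset.card_insert_of_notMem hxσ]⟩

theorem IsComplex.sdiff_freePair {K : Finset (Finset V)} (hK : IsComplex K) {σ τ : Finset V}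
    (h : IsFreePair K σ τ) : IsComplex (K \ {σ, τ}) := by
  obtain ⟨-, -, hστ, huniq⟩ := h
  refine ⟨fun ρ hρ => hK.1 ρ (Finset.mem_sdiff.1 hρ).1, fun ρ hρ π hπρ hπ => ?_⟩
  simp only [Finset.mem_sdiff, Finset.mem_insert, Finset.mem_singleton, not_or] at hρ ⊢
  obtain ⟨hρK, hρσ, hρτ⟩ := hρ
  refine ⟨hK.2 ρ hρK π hπρ hπ, ?_, ?_⟩
  · rintro rfl
    exact hρτ (huniq ρ hρK (Finset.ssubset_iff_subset_ne.2 ⟨hπρ, Ne.symm hρσ⟩))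
  · rintro rfl
    exact hρτ (huniq ρ hρK (hστ.trans_subset hπρ))

theorem CollapseAlong.subset {K L : Finset (Finset V)} {ps : List (Finset V × Finset V)}
    (h : CollapseAlong K ps L) : L ⊆ K := by
  induction h with
  | nil K => exact subset_rfl
  | cons _ _ ih => exact ih.trans Finset.sdiff_subset

/-- Adding a free pair of `K` to a matching on the rest of `K` gives a matching on `K`. -/
theorem IsMatching.insert_freePair {K : Finset (Finset V)} (hK : IsComplex K)
    {p : Finset V × Finset V} (hp : IsFreePair K p.1 p.2) {M : Finset (Finset V × Finset V)}
    (hM : IsMatching (K \ {p.1, p.2}) M) : IsMatching K (insert p M) := by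
  have hmem : ∀ q ∈ M, (q.1 ∈ K ∧ q.1 ≠ p.1 ∧ q.1 ≠ p.2) ∧
      (q.2 ∈ K ∧ q.2 ≠ p.1 ∧ q.2 ≠ p.2) ∧ Facet q.1 q.2 := by
    intro q hq
    simpa [Finset.mem_sdiff] using hM.1 q hq
  refine ⟨fun q hq => ?_, fun q hq r hr hqr => ?_⟩
  · rcases Finset.mem_insert.1 hq with rfl | hq
    · exact ⟨hp.1, hp.2.1, hp.facet hK⟩
    · exact ⟨(hmem q hq).1.1, (hmem q hq).2.1.1, (hmem q hq).2.2⟩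
  · rcases Finset.mem_insert.1 hq with rfl | hqM
    · rcases Finset.mem_insert.1 hr with rfl | hrM
      · rfl
      · have := hmem r hrM
        grind
    · rcases Finset.mem_insert.1 hr with rfl | hrM
      · have := hmem q hqM
        grind
      · exact hM.2 q hqM r hrM hqr

/-- Adding a free pair of `K` to an acyclic set of pairs from `K` preserves acyclicity. -/
theorem IsAcyclicMatching.insert_freePair {K : Finset (Finset V)} {p : Finset V × Finset V}
    (hp : IsFreePair K p.1 p.2) {M : Finset (Finset V × Finset V)} (hMK : ∀ q ∈ M, q.2 ∈ K)
    (hM : IsAcyclicMatching M) : IsAcyclicMatching (insert p M) := by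
  rintro ⟨n, a, b, hn, hinj, hmem, hfac⟩
  refine hM ⟨n, a, b, hn, hinj, fun i hi => ?_, hfac⟩
  refine (Finset.mem_insert.1 (hmem i hi)).resolve_left fun hip => ?_
  subst hip
  obtain ⟨j, hj, hji, hne⟩ : ∃ j < n, (j + 1) % n = i ∧ j ≠ i := by
    rcases i with _ | i
    · exact ⟨n - 1, by omega, by rw [Nat.sub_add_cancel (by omega), Nat.mod_self], by omega⟩
    · exact ⟨i, by omega, Nat.mod_eq_of_lt hi, by omega⟩
  have hbK : b j ∈ K := by
    rcases Finset.mem_insert.1 (hmem j hj) with h | h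
    · have hb : b j = b i := congrArg Prod.snd h
      exact hb ▸ hp.2.1
    · exact hMK _ h
  have hf : Facet (a i) (b j) := hji ▸ hfac j hj
  have hlt : a i ⊂ b j :=
    Finset.ssubset_iff_subset_ne.2 ⟨hf.1, fun h => by simpa [h] using hf.2⟩
  exact hne (hinj j hj i hi (hp.2.2.2 _ hbK hlt))

theorem CollapseAlong.morseMatching {K L : Finset (Finset V)} {ps : List (Finset V × Finset V)}
    (h : CollapseAlong K ps L) (hK : IsComplex K) : MorseMatching K ps.toFinset := by
  induction h with
  | nil K =>
    refine ⟨by simp [IsMatching], ?_⟩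
    rintro ⟨n, a, b, hn, -, hmem, -⟩
    simpa using hmem 0 (by omega)
  | cons hfree _ ih =>
    obtain ⟨hM, hA⟩ := ih (hK.sdiff_freePair hfree)
    rw [List.toFinset_cons]
    exact ⟨hM.insert_freePair hK hfree,
      hA.insert_freePair hfree fun q hq => (Finset.mem_sdiff.1 (hM.1 q hq).2.1).1⟩

theorem isCritical_insert {p : Finset V × Finset V} {M : Finset (Finset V × Finset V)}
    {σ : Finset V} : IsCritical (insert p M) σ ↔ (σ ≠ p.1 ∧ σ ≠ p.2) ∧ IsCritical M σ := by
  simp only [IsCritical, Finset.forall_mem_insert]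

theorem CollapseAlong.isCritical_iff {K L : Finset (Finset V)}
    {ps : List (Finset V × Finset V)} (h : CollapseAlong K ps L) {σ : Finset V} (hσ : σ ∈ K) :
    IsCritical ps.toFinset σ ↔ σ ∈ L := by
  induction h with
  | nil K => simpa [IsCritical] using hσ
  | @cons K L p l _ htail ih =>
    rw [List.toFinset_cons, isCritical_insert]
    have hmem : σ ∈ K \ {p.1, p.2} ↔ σ ≠ p.1 ∧ σ ≠ p.2 := by simp [hσ]
    rw [← hmem]
    exact ⟨fun h => (ih h.1).1 h.2,
      fun h => ⟨htail.subset h, (ih (htail.subset h)).2 h⟩⟩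

/-- If the finite simplicial complex `K` collapses to the subcomplex `L` via the
sequence of elementary collapses removing the pairs `(σ₁,τ₁), …, (σₙ,τₙ)`, then
this collection of pairs is a Morse matching on `K` whose matched (non-critical)
simplices are exactly the simplices of `K ∖ L`. -/
theorem collapse_pairs_form_morse_matching
    (K L : Finset (Finset V)) (ps : List (Finset V × Finset V))
    (hK : IsComplex K) (hL : IsComplex L) (hLK : L ⊆ K)
    (hcol : CollapseAlong K ps L) :
    MorseMatching K ps.toFinset ∧
      ∀ σ ∈ K, (¬ IsCritical ps.toFinset σ ↔ σ ∉ L) := by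
  exact ⟨hcol.morseMatching hK, fun σ hσ => not_congr (hcol.isCritical_iff hσ)⟩
end

section
/- Let K be a finite simplicial complex, M a Morse matching on K, and L ⊆ K a subcomplex such that the set of simplices K ∖ L is a union of pairs of M. Then K collapses to L. In particular, if the critical simplices of M form a subcomplex K_c, then K collapses to K_c. -/
variable {V : Type*} [DecidableEq V]

/-- A fixed-point free self-map of a nonempty finite type has a cycle of length at least two. -/
theorem exists_two_le_minimalPeriod {α : Type*} [Finite α] [Nonempty α] (f : α → α)
    (hf : ∀ x, f x ≠ x) : ∃ x, 2 ≤ Function.minimalPeriod f x := by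
  obtain ⟨x⟩ := ‹Nonempty α›
  obtain ⟨i, j, hij, h⟩ := Finite.exists_ne_map_eq_of_infinite fun n : ℕ => f^[n] x
  wlog hlt : i < j generalizing i j
  · exact this j i hij.symm h.symm (by omega)
  have hper : Function.IsPeriodicPt f (j - i) (f^[i] x) := by
    change f^[j - i] (f^[i] x) = f^[i] x
    rw [← Function.iterate_add_apply, Nat.sub_add_cancel hlt.le]
    exact h.symm
  have hpos := hper.minimalPeriod_pos (by omega)
  have hone : Function.minimalPeriod f (f^[i] x) ≠ 1 := fun h1 =>
    hf _ (Function.minimalPeriod_eq_one_iff_isFixedPt.1 h1)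
  exact ⟨f^[i] x, by omega⟩

theorem IsAcyclicMatching.mono {S M : Finset (Finset V × Finset V)}
    (hM : IsAcyclicMatching M) (h : S ⊆ M) : IsAcyclicMatching S :=
  fun ⟨n, a, b, hn, hb, hab, hfac⟩ => hM ⟨n, a, b, hn, hb, fun i hi => h (hab i hi), hfac⟩

/-- In a nonempty family `T` of pairs of an acyclic matching some pair `p` has the property that
`p.1` is a facet of the upper simplex of no other pair of `T`. -/
theorem IsAcyclicMatching.exists_forall_not_facet {M T : Finset (Finset V × Finset V)}
    (hM : IsAcyclicMatching M) (hinj : ∀ p ∈ M, ∀ q ∈ M, p.2 = q.2 → p = q)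
    (hTM : T ⊆ M) (hT : T.Nonempty) :
    ∃ p ∈ T, ∀ q ∈ T, Facet p.1 q.2 → q = p := by
  by_contra! hcon
  have hstep : ∀ p : T, ∃ q : T, Facet p.1.1 q.1.2 ∧ q ≠ p := fun p => by
    obtain ⟨q, hq, hpq, hne⟩ := hcon p p.2
    exact ⟨⟨q, hq⟩, hpq, fun h => hne (congrArg Subtype.val h)⟩
  choose f hf hne using hstep
  have : Nonempty T := hT.to_subtype
  obtain ⟨x, hx⟩ := exists_two_le_minimalPeriod f hne
  set n := Function.minimalPeriod f x with hn
  refine hM ⟨n, fun i => (f^[n - i] x).1.1, fun i => (f^[n - i] x).1.2, hx, ?_, ?_, ?_⟩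
  · intro i hi j hj h
    have heq : f^[n - i] x = f^[n - j] x :=
      Subtype.ext (hinj _ (hTM (f^[n - i] x).2) _ (hTM (f^[n - j] x).2) h)
    have hmod := (Function.iterate_eq_iterate_iff_of_lt_minimalPeriod
      (f := f) (x := f x) (m := n - i - 1) (n := n - j - 1)
      (by rw [Function.minimalPeriod_apply (Function.minimalPeriod_pos_iff_mem_periodicPts.1
        (by omega))]; omega)
      (by rw [Function.minimalPeriod_apply (Function.minimalPeriod_pos_iff_mem_periodicPts.1
        (by omega))]; omega)).1 (by
        rw [← Function.iterate_succ_apply, ← Function.iterate_succ_apply,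
          show (n - i - 1).succ = n - i by omega, show (n - j - 1).succ = n - j by omega]
        exact heq)
    omega
  · exact fun i _ => hTM (f^[n - i] x).2
  · intro i hi
    have hback : f^[n - (i + 1) % n] x = f^[n - (i + 1)] x := by
      rcases Nat.lt_or_ge (i + 1) n with h | h
      · rw [Nat.mod_eq_of_lt h]
      · have : i + 1 = n := by omega
        rw [this, Nat.mod_self, Nat.sub_zero, Nat.sub_self, hn, Function.iterate_minimalPeriod]
        rfl
    have hsucc : f^[n - i] x = f (f^[n - (i + 1)] x) := by
      rw [← Function.iterate_succ_apply' f, show (n - (i + 1)).succ = n - i by omega]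
    simp only [hback, hsucc]
    exact hf _

/-- If `K ∖ L` is a nonempty union of pairs of an acyclic matching `S`, then some pair of `S` is
a free pair of `K`. -/
theorem exists_isFreePair {K L : Finset (Finset V)} {S : Finset (Finset V × Finset V)}
    (hL : IsComplex L) (hS : ∀ p ∈ S, p.1.Nonempty ∧ Facet p.1 p.2)
    (hinj : ∀ p ∈ S, ∀ q ∈ S, p.2 = q.2 → p = q) (hac : IsAcyclicMatching S)
    (hKL : K \ L = S.biUnion fun p => {p.1, p.2}) (hne : S.Nonempty) :
    ∃ p ∈ S, IsFreePair K p.1 p.2 := by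
  have hmem : ∀ ρ, (ρ ∈ K ∧ ρ ∉ L) ↔ ∃ p ∈ S, ρ = p.1 ∨ ρ = p.2 := fun ρ => by
    rw [← Finset.mem_sdiff, hKL]; simp
  obtain ⟨m, hm, hmax⟩ := S.exists_max_image (fun p => p.2.card) hne
  obtain ⟨p, hp, hfree⟩ := hac.exists_forall_not_facet hinj
    (Finset.filter_subset (fun p => p.2.card = m.2.card) S)
    ⟨m, Finset.mem_filter.2 ⟨hm, rfl⟩⟩
  obtain ⟨hpS, hpm⟩ := Finset.mem_filter.1 hp
  obtain ⟨hpne, hsub, hcard⟩ := hS p hpS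
  have hp1 := (hmem p.1).2 ⟨p, hpS, Or.inl rfl⟩
  have hp2 := (hmem p.2).2 ⟨p, hpS, Or.inr rfl⟩
  refine ⟨p, hpS, hp1.1, hp2.1, hsub.ssubset_of_ne fun h => ?_, fun ρ hρ hlt => ?_⟩
  · rw [h] at hcard; omega
  · have hρL : ρ ∉ L := fun h => hp1.2 (hL.2 ρ h _ hlt.subset hpne)
    obtain ⟨q, hq, hρq⟩ := (hmem ρ).1 ⟨hρ, hρL⟩
    have hqle : q.2.card ≤ m.2.card := hmax q hq
    have hqcard := (hS q hq).2.2
    have hltcard := Finset.card_lt_card hlt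
    rcases hρq with rfl | rfl
    · omega
    · rw [hfree q (Finset.mem_filter.2 ⟨hq, by omega⟩) ⟨hlt.subset, by omega⟩]

/-- If `K ∖ L` is the union of the pairs of an acyclic matching `S`, then `K` collapses to the
subcomplex `L`. -/
theorem collapses_of_sdiff_eq_biUnion {L : Finset (Finset V)} (hL : IsComplex L)
    (S : Finset (Finset V × Finset V)) (K : Finset (Finset V)) (hLK : L ⊆ K)
    (hS : ∀ p ∈ S, p.1.Nonempty ∧ Facet p.1 p.2)
    (hmatch : ∀ p ∈ S, ∀ q ∈ S, (p.1 = q.1 ∨ p.1 = q.2 ∨ p.2 = q.1 ∨ p.2 = q.2) → p = q)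
    (hac : IsAcyclicMatching S) (hKL : K \ L = S.biUnion fun p => {p.1, p.2}) :
    Collapses K L := by
  induction S using Finset.strongInduction generalizing K with
  | H S ih =>
    have hmem : ∀ ρ, (ρ ∈ K ∧ ρ ∉ L) ↔ ∃ p ∈ S, ρ = p.1 ∨ ρ = p.2 := fun ρ => by
      rw [← Finset.mem_sdiff, hKL]; simp
    rcases S.eq_empty_or_nonempty with rfl | hne
    · have hKL' : K ⊆ L := Finset.sdiff_eq_empty_iff_subset.1 (by simpa using hKL)
      rw [hKL'.antisymm hLK]
      exact Relation.ReflTransGen.refl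
    · obtain ⟨p, hp, hfree⟩ := exists_isFreePair hL hS
        (fun p hp q hq h => hmatch p hp q hq (by simp [h])) hac hKL hne
      have hsub : S.erase p ⊆ S := Finset.erase_subset p S
      have hp1 := ((hmem p.1).2 ⟨p, hp, Or.inl rfl⟩).2
      have hp2 := ((hmem p.2).2 ⟨p, hp, Or.inr rfl⟩).2
      refine Relation.ReflTransGen.head ⟨p.1, p.2, hfree, rfl⟩
        (ih _ (Finset.erase_ssubset hp) _ ?_ (fun q hq => hS q (hsub hq))
          (fun q hq r hr => hmatch q (hsub hq) r (hsub hr)) (hac.mono hsub) ?_)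
      · intro ρ hρ
        have h1 : ρ ≠ p.1 := fun h => hp1 (h ▸ hρ)
        have h2 : ρ ≠ p.2 := fun h => hp2 (h ▸ hρ)
        simp [hLK hρ, h1, h2]
      · ext ρ
        simp only [Finset.mem_sdiff, Finset.mem_insert, Finset.mem_singleton, Finset.mem_biUnion,
          Finset.mem_erase]
        constructor
        · rintro ⟨⟨hρK, hρp⟩, hρL⟩
          obtain ⟨q, hq, hρq⟩ := (hmem ρ).1 ⟨hρK, hρL⟩
          exact ⟨q, ⟨fun h => hρp (h ▸ hρq), hq⟩, hρq⟩
        · rintro ⟨q, ⟨hqp, hq⟩, hρq⟩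
          obtain ⟨hρK, hρL⟩ := (hmem ρ).2 ⟨q, hq, hρq⟩
          refine ⟨⟨hρK, fun hρp => hqp (hmatch q hq p hp ?_)⟩, hρL⟩
          rcases hρq with rfl | rfl <;> rcases hρp with h | h <;> simp [h]

/-- If `M` is a Morse matching on the finite simplicial complex `K` and `L ⊆ K` is a
subcomplex such that the set of simplices `K ∖ L` is a union of pairs of `M`,
then `K` collapses to `L`. -/
theorem collapses_of_complement_union_of_pairs
    (K L : Finset (Finset V)) (M : Finset (Finset V × Finset V))
    (hK : IsComplex K) (hM : MorseMatching K M)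
    (hL : IsComplex L) (hLK : L ⊆ K)
    (hunion : ∃ S ⊆ M, K \ L = S.biUnion fun p => {p.1, p.2}) :
    Collapses K L := by
  obtain ⟨S, hSM, hKL⟩ := hunion
  exact collapses_of_sdiff_eq_biUnion hL S K hLK
    (fun p hp => ⟨hK.1 _ (hM.1.1 p (hSM hp)).1, (hM.1.1 p (hSM hp)).2.2⟩)
    (fun p hp q hq => hM.1.2 p (hSM hp) q (hSM hq)) (hM.2.mono hSM) hKL
end

section
/- Let K be a finite simplicial complex whose 1-skeleton is a connected graph, and let M be a Morse matching on K. Let Γ(M) be the graph whose vertex set is the set of all vertices of K and whose edges are those 1-dimensional simplices of K that are not matched with a 2-dimensional simplex in M. Then Γ(M) is connected. -/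
variable {V : Type*} [DecidableEq V]

/-- The relation "the smaller simplex of `q` is a face of the larger simplex of `p`", between
distinct pairs of an acyclic matching, admits no infinite chain. -/
theorem MorseMatching.wellFounded_facet {K : Finset (Finset V)} {M : Finset (Finset V × Finset V)}
    (hM : MorseMatching K M) :
    WellFounded (fun q p : Finset V × Finset V => p ∈ M ∧ q ∈ M ∧ q ≠ p ∧ Facet q.1 p.2) := by
  rw [wellFounded_iff_isEmpty_descending_chain]
  refine ⟨fun ⟨f, hf⟩ => ?_⟩
  have hmem : ∀ i, f i ∈ M := fun i => (hf i).1
  have hrepeat : ∃ n, 0 < n ∧ ∃ i, f i = f (i + n) := by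
    obtain ⟨i, j, hij, h⟩ :=
      Finite.exists_ne_map_eq_of_infinite (fun i => (⟨f i, hmem i⟩ : M))
    have h' : f i = f j := congrArg Subtype.val h
    rcases lt_or_gt_of_ne hij with hlt | hlt
    · exact ⟨j - i, by omega, i, by rw [h']; congr 1; omega⟩
    · exact ⟨i - j, by omega, j, by rw [← h']; congr 1; omega⟩
  classical
  obtain ⟨hpos, i, hi⟩ := Nat.find_spec hrepeat
  have hmin : ∀ m < Nat.find hrepeat, ¬ (0 < m ∧ ∃ i, f i = f (i + m)) :=
    fun m hm => Nat.find_min hrepeat hm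
  generalize Nat.find hrepeat = n at hpos hi hmin
  have hinj : ∀ k l, k < l → l < n → f (i + k) ≠ f (i + l) := fun k l hkl hl h =>
    hmin (l - k) (by omega) ⟨by omega, i + k, by rw [h]; congr 1; omega⟩
  refine hM.2 ⟨n, fun k => (f (i + k)).1, fun k => (f (i + k)).2, ?_, ?_, fun k _ => hmem _, ?_⟩
  · by_contra hlt
    obtain rfl : n = 1 := by omega
    exact (hf i).2.2.1 hi.symm
  · intro k hk l hl hkl
    have heq : f (i + k) = f (i + l) :=
      hM.1.2 _ (hmem _) _ (hmem _) (Or.inr (Or.inr (Or.inr hkl)))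
    by_contra hne
    rcases lt_or_gt_of_ne hne with hlt | hlt
    · exact hinj k l hlt hl heq
    · exact hinj l k hlt hk heq.symm
  · intro k hk
    have hface := (hf (i + k)).2.2.2
    rcases (show k + 1 ≤ n from hk).lt_or_eq with hlt | heq
    · simpa only [Nat.mod_eq_of_lt hlt, add_assoc] using hface
    · simpa only [heq, Nat.mod_self, add_zero, hi, add_assoc] using hface

/-- The endpoints of an edge matched with a triangle are joined by a path of edges that are not
matched with a triangle. -/
theorem MorseMatching.reflTransGen_of_mem {K : Finset (Finset V)}
    {M : Finset (Finset V × Finset V)} (hK : IsComplex K) (hM : MorseMatching K M)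
    (p : Finset V × Finset V) (hp : p ∈ M) (hcard : p.2.card = 3) (a b : V) (hab : a ≠ b)
    (hpab : p.1 = {a, b}) :
    Relation.ReflTransGen
      (fun a b => a ≠ b ∧ ({a, b} : Finset V) ∈ K ∧
        ¬ ∃ τ : Finset V, τ.card = 3 ∧ (({a, b} : Finset V), τ) ∈ M) a b := by
  induction p using hM.wellFounded_facet.induction generalizing a b with
  | _ p ih =>
  obtain ⟨-, hpK, hsub, -⟩ := hM.1.1 p hp
  rw [hpab] at hsub
  obtain ⟨c, hc, hcab⟩ : ∃ c ∈ p.2, c ∉ ({a, b} : Finset V) :=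
    Finset.exists_mem_notMem_of_card_lt_card (by rw [Finset.card_pair hab]; omega)
  have hca : c ≠ a := fun h => hcab (by simp [h])
  have hcb : c ≠ b := fun h => hcab (by simp [h])
  have hedge : ∀ x y, x ≠ y → x ∈ p.2 → y ∈ p.2 → ({x, y} : Finset V) ≠ {a, b} →
      Relation.ReflTransGen
        (fun a b => a ≠ b ∧ ({a, b} : Finset V) ∈ K ∧
          ¬ ∃ τ : Finset V, τ.card = 3 ∧ (({a, b} : Finset V), τ) ∈ M) x y := by
    intro x y hxy hx hy hne
    have hxyp : ({x, y} : Finset V) ⊆ p.2 := by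
      simp [Finset.insert_subset_iff, hx, hy]
    by_cases hτ : ∃ τ : Finset V, τ.card = 3 ∧ (({x, y} : Finset V), τ) ∈ M
    · obtain ⟨τ, hτ3, hτM⟩ := hτ
      refine ih _ ⟨hp, hτM, ?_, hxyp, ?_⟩ hτM hτ3 x y hxy rfl
      · rintro rfl
        exact hne hpab
      · simp [Finset.card_pair hxy, hcard]
    · exact .single ⟨hxy, hK.2 _ hpK _ hxyp (by simp), hτ⟩
  have ha : a ∈ p.2 := hsub (by simp)
  have hb : b ∈ p.2 := hsub (by simp)
  refine (hedge a c hca.symm ha hc ?_).trans (hedge c b hcb hc hb ?_)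
  · exact fun h => hcab (h ▸ by simp)
  · exact fun h => hcab (h ▸ by simp)

/-- Let `K` be a finite simplicial complex whose 1-skeleton is connected and `M` a
Morse matching on `K`. Then the graph `Γ(M)`, on all vertices of `K` and with edges the
1-simplices of `K` not matched with a 2-simplex in `M`, is connected. -/
theorem graph_after_removing_matched_edges_connected
    (K : Finset (Finset V)) (M : Finset (Finset V × Finset V))
    (hK : IsComplex K) (hconn : SkeletonConnected K) (hM : MorseMatching K M) :
    ∀ u v : V, ({u} : Finset V) ∈ K → ({v} : Finset V) ∈ K →
      Relation.ReflTransGen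
        (fun a b => a ≠ b ∧ ({a, b} : Finset V) ∈ K ∧
          ¬ ∃ τ : Finset V, τ.card = 3 ∧ (({a, b} : Finset V), τ) ∈ M) u v := by
  intro u v hu hv
  induction hconn u v hu hv with
  | refl => exact .refl
  | @tail b c _ hbc ih =>
    obtain ⟨hne, hbcK⟩ := hbc
    refine (ih (hK.2 _ hbcK _ (by simp) (by simp))).trans ?_
    by_cases hτ : ∃ τ : Finset V, τ.card = 3 ∧ (({b, c} : Finset V), τ) ∈ M
    · obtain ⟨τ, hτ3, hτM⟩ := hτ
      exact hM.reflTransGen_of_mem hK _ hτM hτ3 b c hne rfl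
    · exact .single ⟨hne, hbcK, hτ⟩
end

section
/- Let K be a finite connected 2-dimensional simplicial complex with Euler characteristic χ(K) = f₀ − f₁ + f₂ (where fᵢ is the number of i-dimensional simplices), and let k ∈ ℕ. Then there exists a Morse matching on K with at most k critical 2-dimensional simplices if and only if there exists a Morse matching on K with at most 2(k+1) − χ(K) critical simplices in total. -/
variable {V : Type*} [DecidableEq V]

/-- In a Morse matching, no nonempty family of simplices admits a successor for each of its
members: following gradient paths inside the family would produce a cycle. -/
theorem MorseMatching.eq_empty_of_forall_exists_next {K : Finset (Finset V)}
    {M : Finset (Finset V × Finset V)} (hM : MorseMatching K M) (S : Finset (Finset V))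
    (hS : ∀ a ∈ S, ∃ b, (a, b) ∈ M ∧ ∃ a' ∈ S, a' ≠ a ∧ Facet a' b) : S = ∅ := by
  by_contra hne
  obtain ⟨x, hx⟩ := Finset.nonempty_iff_ne_empty.mpr hne
  choose b hb next hnext hne' hfacet using fun a : S => hS a a.2
  let f : S → S := fun a => ⟨next a, hnext a⟩
  obtain ⟨m, n, hmn, heq⟩ := Finite.exists_ne_map_eq_of_infinite fun n : ℕ => f^[n] ⟨x, hx⟩
  obtain ⟨y, hy⟩ : ∃ y, 0 < Function.minimalPeriod f y := by
    wlog hlt : m < n generalizing m n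
    · exact this n m hmn.symm heq.symm (by omega)
    refine ⟨f^[m] ⟨x, hx⟩, Function.IsPeriodicPt.minimalPeriod_pos (n := n - m) (by omega) ?_⟩
    change f^[n - m] (f^[m] ⟨x, hx⟩) = _
    rw [← Function.iterate_add_apply, Nat.sub_add_cancel hlt.le]
    exact heq.symm
  have hp : Function.minimalPeriod f y ≠ 1 := fun h =>
    hne' y (congrArg Subtype.val (Function.minimalPeriod_eq_one_iff_isFixedPt.mp h))
  refine hM.2 ⟨Function.minimalPeriod f y, fun i => (f^[i] y : S), fun i => b (f^[i] y),
    by omega, fun i hi j hj hij => ?_, fun i _ => hb _, fun i _ => ?_⟩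
  · have := hM.1.2 _ (hb (f^[i] y)) _ (hb (f^[j] y)) (Or.inr (Or.inr (Or.inr hij)))
    exact Function.iterate_injOn_Iio_minimalPeriod hi hj (Subtype.ext (congrArg Prod.fst this))
  · change Facet (f^[(i + 1) % Function.minimalPeriod f y] y).1 _
    rw [Function.iterate_mod_minimalPeriod_eq, Function.iterate_succ_apply']
    exact hfacet _

/-- The members of the pairs of a matching contribute nothing to the Euler characteristic. -/
theorem IsMatching.totalCrit_add_euler {K : Finset (Finset V)}
    {M : Finset (Finset V × Finset V)} (hM : IsMatching K M) (hK : IsComplex K)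
    (hdim : ∀ σ ∈ K, σ.card ≤ 3) :
    (totalCrit K M : ℤ) + (({σ : Finset V | σ ∈ K ∧ σ.card = 1}.ncard : ℤ)
            - ({σ : Finset V | σ ∈ K ∧ σ.card = 2}.ncard : ℤ)
            + ({σ : Finset V | σ ∈ K ∧ σ.card = 3}.ncard : ℤ))
      = 2 * ((critCount K M 0 : ℤ) + critCount K M 2) := by
  classical
  have hpos : ∀ σ ∈ K, 1 ≤ σ.card := fun σ hσ => (hK.1 σ hσ).card_pos
  have ncard_eq (p : Finset V → Prop) [DecidablePred p] :
      ({σ : Finset V | σ ∈ K ∧ p σ}.ncard : ℤ) = ∑ σ ∈ K, if p σ then 1 else 0 := by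
    rw [Finset.sum_boole, ← Set.ncard_coe_finset]
    simp
  have hpair : ∑ σ ∈ K with ¬ IsCritical M σ, (-1 : ℤ) ^ σ.card = 0 := by
    have hunion : (K.filter fun σ => ¬ IsCritical M σ) =
        M.biUnion fun p => {p.1, p.2} := by
      ext σ
      simp only [Finset.mem_filter, Finset.mem_biUnion, Finset.mem_insert,
        Finset.mem_singleton]
      constructor
      · rintro ⟨_, h⟩
        simp only [IsCritical, not_forall] at h
        obtain ⟨p, hp, h⟩ := h
        exact ⟨p, hp, by tauto⟩
      · rintro ⟨p, hp, h⟩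
        refine ⟨?_, fun hc => by have := hc p hp; tauto⟩
        rcases h with rfl | rfl
        exacts [(hM.1 p hp).1, (hM.1 p hp).2.1]
    rw [hunion, Finset.sum_biUnion]
    · refine Finset.sum_eq_zero fun p hp => ?_
      have hc := (hM.1 p hp).2.2.2
      rw [Finset.sum_pair (fun h => by rw [h] at hc; omega), hc, pow_succ]
      ring
    · intro p hp q hq hpq
      rw [Function.onFun, Finset.disjoint_left]
      intro σ h₁ h₂
      simp only [Finset.mem_insert, Finset.mem_singleton] at h₁ h₂
      exact hpq (hM.2 p hp q hq (by grind))
  have hsplit := Finset.sum_filter_add_sum_filter_not K (IsCritical M)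
    fun σ => (-1 : ℤ) ^ σ.card
  rw [hpair, add_zero, Finset.sum_filter] at hsplit
  unfold totalCrit critCount
  simp only [ncard_eq]
  suffices h : ∑ σ ∈ K, ((if IsCritical M σ then (1 : ℤ) else 0)
      + ((if σ.card = 1 then 1 else 0) - (if σ.card = 2 then 1 else 0)
        + if σ.card = 3 then 1 else 0)
      + (-1) ^ σ.card - 2 * ((if σ.card = 0 + 1 ∧ IsCritical M σ then 1 else 0)
        + if σ.card = 2 + 1 ∧ IsCritical M σ then 1 else 0)
      - if IsCritical M σ then (-1) ^ σ.card else 0) = 0 by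
    simp only [Finset.sum_add_distrib, Finset.sum_sub_distrib, ← Finset.mul_sum] at h
    linarith
  refine Finset.sum_eq_zero fun σ hσ => ?_
  have h1 := hpos σ hσ
  have h3 := hdim σ hσ
  by_cases hc : IsCritical M σ <;> generalize σ.card = m at * <;> interval_cases m <;> simp [hc]

/-- A Morse matching on a nonempty complex has a critical vertex. -/
theorem MorseMatching.critCount_zero_pos {K : Finset (Finset V)}
    {M : Finset (Finset V × Finset V)} (hM : MorseMatching K M) (hK : IsComplex K)
    {r : V} (hr : {r} ∈ K) : 1 ≤ critCount K M 0 := by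
  unfold critCount
  rw [Nat.one_le_iff_ne_zero, Ne,
    Set.ncard_eq_zero ((K.finite_toSet).subset fun σ h => h.1), Set.eq_empty_iff_forall_notMem]
  intro h
  have hempty := hM.eq_empty_of_forall_exists_next (K.filter fun σ => σ.card = 1) ?_
  · have : {r} ∈ K.filter fun σ => σ.card = 1 := by simp [hr]
    simp [hempty] at this
  intro a ha
  rw [Finset.mem_filter] at ha
  obtain ⟨haK, ha⟩ := ha
  have hnc : ¬ IsCritical M a := fun hc => h a ⟨haK, ha, hc⟩
  simp only [IsCritical, not_forall] at hnc
  obtain ⟨p, hp, hnc⟩ := hnc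
  obtain ⟨h1, h2, hsub, hcard⟩ := hM.1.1 p hp
  have hp1 := (hK.1 _ h1).card_pos
  have hap : a = p.1 := by
    by_contra hne
    have hap : a = p.2 := by tauto
    rw [← hap] at hcard
    omega
  subst hap
  obtain ⟨w, hw⟩ : (p.2 \ p.1).Nonempty := by
    rw [← Finset.card_pos, Finset.card_sdiff_of_subset hsub]
    omega
  rw [Finset.mem_sdiff] at hw
  refine ⟨p.2, hp, {w}, ?_, ?_, by simpa using hw.1, by simp; omega⟩
  · simpa using hK.2 _ h2 {w} (by simpa using hw.1) (by simp)
  · intro h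
    exact hw.2 (h ▸ by simp)

/-- The graph formed by the edges of `K` that are not matched to a triangle. -/
def unmatchedGraph (K : Finset (Finset V)) (M : Finset (Finset V × Finset V)) :
    SimpleGraph V where
  Adj u v := u ≠ v ∧ {u, v} ∈ K ∧ ∀ t, (({u, v} : Finset V), t) ∉ M
  symm := ⟨fun u v h => by rwa [ne_comm, Finset.pair_comm]⟩
  loopless := ⟨fun _ h => h.1 rfl⟩

/-- Removing the edges that a Morse matching pairs with triangles keeps the 1-skeleton
connected. -/
theorem MorseMatching.reachable_unmatchedGraph {K : Finset (Finset V)}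
    {M : Finset (Finset V × Finset V)} (hM : MorseMatching K M) (hK : IsComplex K)
    (hconn : SkeletonConnected K) {r v : V} (hr : {r} ∈ K) (hv : {v} ∈ K) :
    (unmatchedGraph K M).Reachable r v := by
  classical
  set G := unmatchedGraph K M
  let S : Finset (Finset V) :=
    K.filter fun σ => ∃ x y, G.Reachable r x ∧ ¬ G.Reachable r y ∧ σ = {x, y}
  have hS : S = ∅ := by
    refine hM.eq_empty_of_forall_exists_next S fun a ha => ?_
    obtain ⟨haK, x, y, hx, hy, rfl⟩ := Finset.mem_filter.mp ha
    have hxy : x ≠ y := fun h => hy (h ▸ hx)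
    obtain ⟨t, ht⟩ : ∃ t, (({x, y} : Finset V), t) ∈ M := by
      by_contra! hcon
      exact hy (hx.trans (SimpleGraph.Adj.reachable ⟨hxy, haK, hcon⟩))
    obtain ⟨-, htK, hsub, hcard⟩ := hM.1.1 _ ht
    simp only at htK hsub hcard
    obtain ⟨z, hz⟩ : (t \ {x, y}).Nonempty := by
      rw [← Finset.card_pos, Finset.card_sdiff_of_subset hsub]
      omega
    rw [Finset.mem_sdiff, Finset.mem_insert, Finset.mem_singleton, not_or] at hz
    obtain ⟨hzt, hzx, hzy⟩ := hz
    have hxt : x ∈ t := hsub (by simp)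
    have hyt : y ∈ t := hsub (by simp)
    rw [Finset.card_pair hxy] at hcard
    refine ⟨t, ht, ?_⟩
    by_cases hzr : G.Reachable r z
    · have hst : {z, y} ⊆ t := by grind
      refine ⟨{z, y}, Finset.mem_filter.mpr ⟨hK.2 _ htK _ hst (by simp), z, y, hzr, hy, rfl⟩,
        fun h => ?_, hst, by rw [Finset.card_pair hzy, hcard]⟩
      have : z ∈ ({x, y} : Finset V) := h ▸ by simp
      grind
    · have hst : {x, z} ⊆ t := by grind
      refine ⟨{x, z}, Finset.mem_filter.mpr ⟨hK.2 _ htK _ hst (by simp), x, z, hx, hzr, rfl⟩,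
        fun h => ?_, hst, by rw [Finset.card_pair (Ne.symm hzx), hcard]⟩
      have : z ∈ ({x, y} : Finset V) := h ▸ by simp
      grind
  induction hconn r v hr hv with
  | refl => rfl
  | @tail b c _ hbc ih =>
    have hb := ih (hK.2 _ hbc.2 _ (by simp) (by simp))
    by_contra hc
    have : {b, c} ∈ S := Finset.mem_filter.mpr ⟨hbc.2, b, c, hb, hc, rfl⟩
    simp [hS] at this

/-- A reachable vertex other than the root has a neighbour closer to the root. -/
theorem SimpleGraph.Reachable.exists_adj_dist_lt {W : Type*} {G : SimpleGraph W} {r v : W}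
    (h : G.Reachable v r) (hne : v ≠ r) : ∃ w, G.Adj v w ∧ G.dist w r < G.dist v r := by
  obtain ⟨p, hp⟩ := h.exists_walk_length_eq_dist
  cases p with
  | nil => exact absurd rfl hne
  | cons hadj q =>
    rw [SimpleGraph.Walk.length_cons] at hp
    exact ⟨_, hadj, by have := SimpleGraph.dist_le q; omega⟩

/-- The part of a Morse matching pairing edges with triangles can be completed to a Morse
matching with the same critical triangles and only one critical vertex. -/
theorem MorseMatching.exists_critCount_zero_le_one {K : Finset (Finset V)}
    {M : Finset (Finset V × Finset V)} (hM : MorseMatching K M) (hK : IsComplex K)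
    (hconn : SkeletonConnected K) (hdim : ∀ σ ∈ K, σ.card ≤ 3) {r : V} (hr : {r} ∈ K) :
    ∃ M', MorseMatching K M' ∧ critCount K M' 0 ≤ 1 ∧ critCount K M' 2 ≤ critCount K M 2 := by
  classical
  set G := unmatchedGraph K M
  have hpar (v : V) : ∃ w, {v} ∈ K → v ≠ r → G.Adj v w ∧ G.dist w r < G.dist v r := by
    by_cases hv : {v} ∈ K ∧ v ≠ r
    · obtain ⟨w, hw⟩ :=
        (hM.reachable_unmatchedGraph hK hconn hr hv.1).symm.exists_adj_dist_lt hv.2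
      exact ⟨w, fun _ _ => hw⟩
    · exact ⟨v, fun h h' => absurd ⟨h, h'⟩ hv⟩
  choose par hpar using hpar
  let up := M.filter fun p => p.1.card = 2
  let tree : Finset (Finset V × Finset V) :=
    ((K.biUnion id).filter fun v => {v} ∈ K ∧ v ≠ r).image fun v => ({v}, {v, par v})
  have mem_up {p} : p ∈ up ↔ p ∈ M ∧ p.1.card = 2 := Finset.mem_filter
  have mem_tree {p} : p ∈ tree ↔ ∃ v, ({v} ∈ K ∧ v ≠ r) ∧ (({v} : Finset V), {v, par v}) = p := by
    simp only [tree, Finset.mem_image, Finset.mem_filter, Finset.mem_biUnion, id]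
    exact exists_congr fun v => and_congr_left fun _ =>
      ⟨fun h => h.2, fun h => ⟨⟨{v}, h.1, by simp⟩, h⟩⟩
  have tree_inj {v w : V} (hv : {v} ∈ K ∧ v ≠ r) (hw : {w} ∈ K ∧ w ≠ r)
      (h : ({v, par v} : Finset V) = {w, par w}) : v = w := by
    by_contra hne
    have h1 : v ∈ ({w, par w} : Finset V) := h ▸ by simp
    have h2 : w ∈ ({v, par v} : Finset V) := h ▸ by simp
    have h1 : v = par w := by grind
    have h2 : w = par v := by grind
    have h3 := (hpar v hv.1 hv.2).2
    have h4 := (hpar w hw.1 hw.2).2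
    rw [← h1] at h4
    rw [← h2] at h3
    omega
  have up_tree {p q} (hp : p ∈ up) (hq : q ∈ tree)
      (h : p.1 = q.1 ∨ p.1 = q.2 ∨ p.2 = q.1 ∨ p.2 = q.2) : False := by
    obtain ⟨v, hv, rfl⟩ := mem_tree.mp hq
    obtain ⟨hpM, hp2⟩ := mem_up.mp hp
    have hp3 := (hM.1.1 p hpM).2.2.2
    have hadj := (hpar v hv.1 hv.2).1
    have hcard := Finset.card_pair hadj.1
    rcases h with h | h | h | h
    · simp [h] at hp2
    · exact hadj.2.2 p.2 ((Prod.ext h rfl : p = ({v, par v}, p.2)) ▸ hpM)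
    · simp only [h, Finset.card_singleton] at hp3; omega
    · simp only [h] at hp3; omega
  refine ⟨up ∪ tree, ⟨⟨?_, ?_⟩, ?_⟩, ?_, ?_⟩
  · intro p hp
    rcases Finset.mem_union.mp hp with hp | hp
    · exact hM.1.1 p (mem_up.mp hp).1
    · obtain ⟨v, hv, rfl⟩ := mem_tree.mp hp
      have hadj := (hpar v hv.1 hv.2).1
      exact ⟨hv.1, hadj.2.1, by simp, by simp [Finset.card_pair hadj.1]⟩
  · intro p hp q hq h
    rcases Finset.mem_union.mp hp with hp | hp <;> rcases Finset.mem_union.mp hq with hq | hq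
    · exact hM.1.2 p (mem_up.mp hp).1 q (mem_up.mp hq).1 h
    · exact (up_tree hp hq h).elim
    · exact (up_tree hq hp (by grind)).elim
    · obtain ⟨v, hv, rfl⟩ := mem_tree.mp hp
      obtain ⟨w, hw, rfl⟩ := mem_tree.mp hq
      have hcv := Finset.card_pair (hpar v hv.1 hv.2).1.1
      have hcw := Finset.card_pair (hpar w hw.1 hw.2).1.1
      have hvw : v = w := by
        rcases h with h | h | h | h
        · simpa using h
        · have := congrArg Finset.card h
          simp only [hcw, Finset.card_singleton] at this; omega
        · have := congrArg Finset.card h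
          simp only [hcv, Finset.card_singleton] at this; omega
        · exact tree_inj hv hw h
      rw [hvw]
  · rintro ⟨n, a, b, hn, hinj, hmem, hface⟩
    have hsucc (i : ℕ) : (i + 1) % n < n := Nat.mod_lt _ (by omega)
    by_cases hall : ∀ i < n, (a i, b i) ∈ up
    · exact hM.2 ⟨n, a, b, hn, hinj, fun i hi => (mem_up.mp (hall i hi)).1, hface⟩
    push Not at hall
    obtain ⟨i, hi, hiu⟩ := hall
    have hstep (i : ℕ) (hi : i < n) (ht : (a i, b i) ∈ tree) :
        (a ((i + 1) % n), b ((i + 1) % n)) ∈ tree ∧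
        ∀ v w, a i = {v} → a ((i + 1) % n) = {w} → G.dist w r < G.dist v r := by
      obtain ⟨v, hv, hab⟩ := mem_tree.mp ht
      obtain ⟨ha, hb⟩ := Prod.mk.inj hab
      have hadj := hpar v hv.1 hv.2
      have hc := (hface i hi).2
      rw [← hb, Finset.card_pair hadj.1.1] at hc
      have ht' : (a ((i + 1) % n), b ((i + 1) % n)) ∈ tree := by
        refine (Finset.mem_union.mp (hmem _ (hsucc i))).resolve_left fun h => ?_
        have := (mem_up.mp h).2
        simp only at this
        omega
      refine ⟨ht', fun v' w hv' hw => ?_⟩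
      obtain rfl : v = v' := by simpa [hv'] using ha
      have hwb : w ∈ b i := (hface i hi).1 (by simp [hw])
      rw [← hb, Finset.mem_insert, Finset.mem_singleton] at hwb
      rcases hwb with rfl | rfl
      · exfalso
        obtain ⟨u, hu, hab'⟩ := mem_tree.mp ht'
        obtain ⟨ha', hb'⟩ := Prod.mk.inj hab'
        obtain rfl : u = w := by simpa [hw] using ha'
        have := hinj i hi _ (hsucc i) (hb.symm.trans hb')
        rcases Nat.lt_or_ge (i + 1) n with h | h
        · rw [Nat.mod_eq_of_lt h] at this; omega
        · rw [show i + 1 = n by omega, Nat.mod_self] at this; omega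
      · exact hadj.2
    have hit : (a i, b i) ∈ tree := (Finset.mem_union.mp (hmem i hi)).resolve_left hiu
    let T := (Finset.range n).filter fun i => (a i, b i) ∈ tree
    have hT (i : ℕ) : i ∈ T ↔ i < n ∧ (a i, b i) ∈ tree := by simp [T]
    obtain ⟨j, hjT, hmin⟩ := T.exists_min_image
      (fun j => sInf {d | ∃ v, a j = {v} ∧ d = G.dist v r}) ⟨i, (hT i).mpr ⟨hi, hit⟩⟩
    obtain ⟨hj, hjt⟩ := (hT j).mp hjT
    obtain ⟨hjt', hlt⟩ := hstep j hj hjt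
    have hle := hmin _ ((hT _).mpr ⟨hsucc j, hjt'⟩)
    obtain ⟨v, -, hv⟩ := mem_tree.mp hjt
    obtain ⟨w, -, hw⟩ := mem_tree.mp hjt'
    have hv := (Prod.mk.inj hv).1.symm
    have hw := (Prod.mk.inj hw).1.symm
    have := hlt v w hv hw
    simp [hv, hw] at hle
    omega
  · unfold critCount
    refine (Set.ncard_le_ncard (t := {{r}}) ?_).trans (Set.ncard_singleton _).le
    rintro σ ⟨hσ, hcard, hc⟩
    obtain ⟨v, rfl⟩ := Finset.card_eq_one.mp hcard
    by_contra hvr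
    exact (hc _ (Finset.mem_union_right _
      (mem_tree.mpr ⟨v, ⟨hσ, fun h => hvr (by simp [h])⟩, rfl⟩))).1 rfl
  · refine Set.ncard_le_ncard ?_ (K.finite_toSet.subset fun σ h => h.1)
    rintro σ ⟨hσ, hcard, hc⟩
    refine ⟨hσ, hcard, fun p hp => ?_⟩
    have hp2 := hM.1.1 p hp
    have hp3 := hdim _ hp2.2.1
    have hp4 := hp2.2.2.2
    refine ⟨fun h => by rw [← h] at hp4; omega, fun h => ?_⟩
    exact (hc p (Finset.mem_union_left _ (mem_up.mpr ⟨hp, by rw [← h] at hp4; omega⟩))).2 h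

/-- For a finite connected 2-dimensional simplicial complex `K` with Euler
characteristic `χ(K) = f₀ − f₁ + f₂` and `k ∈ ℕ`: there exists a Morse matching on `K`
with at most `k` critical 2-simplices iff there exists a Morse matching on `K` with at
most `2(k+1) − χ(K)` critical simplices in total. -/
theorem morse_matching_crit_two_iff_total
    (K : Finset (Finset V)) (k : ℕ)
    (hK : IsComplex K) (hconn : SkeletonConnected K)
    (hdim : ∀ σ ∈ K, σ.card ≤ 3) (hdim2 : ∃ σ ∈ K, σ.card = 3) :
    (∃ M : Finset (Finset V × Finset V), MorseMatching K M ∧ critCount K M 2 ≤ k) ↔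
      ∃ M : Finset (Finset V × Finset V), MorseMatching K M ∧
        (totalCrit K M : ℤ) ≤ 2 * ((k : ℤ) + 1) -
          (({σ : Finset V | σ ∈ K ∧ σ.card = 1}.ncard : ℤ)
            - ({σ : Finset V | σ ∈ K ∧ σ.card = 2}.ncard : ℤ)
            + ({σ : Finset V | σ ∈ K ∧ σ.card = 3}.ncard : ℤ)) := by
  obtain ⟨τ, hτ, hτ3⟩ := hdim2
  obtain ⟨r, hrτ⟩ := hK.1 τ hτ
  have hr : {r} ∈ K := hK.2 τ hτ {r} (by simpa using hrτ) (by simp)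
  constructor
  · rintro ⟨M, hM, hk⟩
    obtain ⟨M', hM', h0, h2⟩ := hM.exists_critCount_zero_le_one hK hconn hdim hr
    have := hM'.1.totalCrit_add_euler hK hdim
    exact ⟨M', hM', by omega⟩
  · rintro ⟨M, hM, hk⟩
    have := hM.1.totalCrit_add_euler hK hdim
    have := hM.critCount_zero_pos hK hr
    exact ⟨M, hM, by omega⟩
end

section
/- Let K be a finite connected simplicial complex with n simplices, p a vertex of K, c ≥ 1 an integer, and let K̂_c be the amplified complex, i.e., the wedge sum of n^{c−1} copies of K at the basepoint p. If K is not collapsible, then every Morse matching on K̂_c has more than n^{c−1} critical simplices. -/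
variable {V : Type*} [DecidableEq V]

/-- The vertex set of the wedge of `m` copies of a complex on `V` pointed at `p`:
the basepoint `none = ⋆` together with `(V ∖ {p}) × {1,…,m}`. -/
abbrev WedgeVertex (V : Type*) (p : V) (m : ℕ) := Option ({ v : V // v ≠ p } × Fin m)

/-- The `i`-th injection `V → WedgeVertex V p m`, sending `p` to the basepoint and
any `v ≠ p` to `(v, i)`. -/
def wedgeMap (p : V) (m : ℕ) (i : Fin m) (v : V) : WedgeVertex V p m :=
  if h : v = p then none else some ⟨⟨v, h⟩, i⟩

/-- The wedge sum of `m` copies of the pointed complex `(K, p)`: the simplices are the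
images of simplices of `K` under the `m` injections. -/
def wedge (K : Finset (Finset V)) (p : V) (m : ℕ) : Finset (Finset (WedgeVertex V p m)) :=
  Finset.univ.biUnion fun i : Fin m => K.image fun σ => σ.image (wedgeMap p m i)

/-- A relation on a nonempty finite set in which every element has a successor other than
itself contains a cycle of length at least two through distinct elements. -/
theorem exists_cycle_of_forall_exists_ne {α : Type*} (S : Finset α) (hS : S.Nonempty)
    (r : α → α → Prop) (h : ∀ x ∈ S, ∃ y ∈ S, y ≠ x ∧ r x y) :
    ∃ (n : ℕ) (x : ℕ → α), 2 ≤ n ∧ (∀ i, x i ∈ S) ∧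
      (∀ i < n, ∀ j < n, x i = x j → i = j) ∧ ∀ i < n, r (x i) (x ((i + 1) % n)) := by
  choose! f hfS hne hr using h
  obtain ⟨x₀, hx₀⟩ := hS
  have hmaps : Set.MapsTo f S S := fun x hx => hfS x hx
  have hit : ∀ k, f^[k] x₀ ∈ S := fun k => hmaps.iterate k hx₀
  obtain ⟨a, b, hab, heq⟩ : ∃ a b : ℕ, a < b ∧ f^[a] x₀ = f^[b] x₀ := by
    obtain ⟨a, -, b, -, hne', heq⟩ :=
      Set.infinite_univ.exists_ne_map_eq_of_mapsTo (f := fun k => f^[k] x₀)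
        (fun k _ => hit k) S.finite_toSet
    rcases lt_or_gt_of_ne hne' with hlt | hlt
    · exact ⟨a, b, hlt, heq⟩
    · exact ⟨b, a, hlt, heq.symm⟩
  set y := f^[a] x₀ with hy
  have hyS : ∀ k, f^[k] y ∈ S := fun k => hmaps.iterate k (hit a)
  have hper : Function.IsPeriodicPt f (b - a) y := by
    change f^[b - a] y = y
    rw [hy, ← Function.iterate_add_apply, Nat.sub_add_cancel hab.le, ← heq]
  have hpos : 0 < Function.minimalPeriod f y := hper.minimalPeriod_pos (by omega)
  have hone : Function.minimalPeriod f y ≠ 1 := fun h1 =>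
    hne y (hit a) (Function.minimalPeriod_eq_one_iff_isFixedPt.mp h1)
  refine ⟨Function.minimalPeriod f y, fun k => f^[k] y, by omega, hyS, ?_, ?_⟩
  · intro i hi j hj hij
    exact Function.iterate_injOn_Iio_minimalPeriod hi hj hij
  · intro i _
    change r (f^[i] y) (f^[(i + 1) % Function.minimalPeriod f y] y)
    rw [Function.iterate_mod_minimalPeriod_eq, Function.iterate_succ_apply']
    exact hr _ (hyS i)

/-- The gradient paths of an acyclic matching cannot be continued forever forwards. -/
theorem MorseMatching.exists_forall_facet_eq {W : Type*} {K : Finset (Finset W)}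
    {M S : Finset (Finset W × Finset W)} (hM : MorseMatching K M) (hSM : S ⊆ M)
    (hS : S.Nonempty) : ∃ p ∈ S, ∀ q ∈ S, Facet q.1 p.2 → q = p := by
  by_contra! h
  obtain ⟨n, x, hn, hxS, hinj, hr⟩ := exists_cycle_of_forall_exists_ne S hS
    (fun p q => Facet q.1 p.2) fun p hp => by
      obtain ⟨q, hq, hf, hne⟩ := h p hp
      exact ⟨q, hq, hne, hf⟩
  refine hM.2 ⟨n, fun i => (x i).1, fun i => (x i).2, hn, fun i hi j hj hij => ?_,
    fun i _ => hSM (hxS i), hr⟩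
  exact hinj i hi j hj (hM.1.2 _ (hSM (hxS i)) _ (hSM (hxS j)) (Or.inr (Or.inr (Or.inr hij))))

/-- The gradient paths of an acyclic matching cannot be continued forever backwards. -/
theorem MorseMatching.exists_forall_coface_eq {W : Type*} {K : Finset (Finset W)}
    {M S : Finset (Finset W × Finset W)} (hM : MorseMatching K M) (hSM : S ⊆ M)
    (hS : S.Nonempty) : ∃ p ∈ S, ∀ q ∈ S, Facet p.1 q.2 → q = p := by
  by_contra! h
  obtain ⟨n, x, hn, hxS, hinj, hr⟩ := exists_cycle_of_forall_exists_ne S hS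
    (fun p q => Facet p.1 q.2) fun p hp => by
      obtain ⟨q, hq, hf, hne⟩ := h p hp
      exact ⟨q, hq, hne, hf⟩
  refine hM.2 ⟨n, fun i => (x (n - 1 - i)).1, fun i => (x (n - 1 - i)).2, hn,
    fun i hi j hj hij => ?_, fun i _ => hSM (hxS _), fun i hi => ?_⟩
  · have := hinj (n - 1 - i) (by omega) (n - 1 - j) (by omega)
      (hM.1.2 _ (hSM (hxS _)) _ (hSM (hxS _)) (Or.inr (Or.inr (Or.inr hij))))
    omega
  · rcases Nat.lt_or_ge (i + 1) n with hlt | hge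
    · have := hr (n - 1 - (i + 1)) (by omega)
      rw [show n - 1 - (i + 1) + 1 = n - 1 - i by omega, Nat.mod_eq_of_lt (by omega)] at this
      rwa [Nat.mod_eq_of_lt hlt]
    · obtain rfl : n = i + 1 := by omega
      have := hr i hi
      simpa using this

/-- Every Morse matching on a nonempty complex has a critical vertex. -/
theorem MorseMatching.exists_critical_vertex {K : Finset (Finset V)}
    {M : Finset (Finset V × Finset V)} (hK : IsComplex K) (hM : MorseMatching K M)
    (hne : K.Nonempty) : ∃ v, {v} ∈ K ∧ IsCritical M {v} := by
  by_contra! h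
  have hmatch : ∀ v, {v} ∈ K → ∃ q ∈ M, q.1 = {v} := by
    intro v hv
    have := h v hv
    simp only [IsCritical, not_forall, not_and_or, not_not] at this
    obtain ⟨q, hq, h1 | h2⟩ := this
    · exact ⟨q, hq, h1.symm⟩
    · obtain ⟨hq1, -, -, hc⟩ := hM.1.1 q hq
      have := (hK.1 _ hq1).card_pos
      rw [← h2, Finset.card_singleton] at hc
      omega
  obtain ⟨σ, hσ⟩ := hne
  obtain ⟨v, hv⟩ := hK.1 σ hσ
  obtain ⟨q₀, hq₀, hq₀1⟩ := hmatch v (hK.2 σ hσ {v} (by simpa using hv) (by simp))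
  obtain ⟨q, hq, hmax⟩ := hM.exists_forall_facet_eq
    (Finset.filter_subset (fun q => q.1.card = 1) M) ⟨q₀, by simp [hq₀, hq₀1]⟩
  rw [Finset.mem_filter] at hq
  obtain ⟨-, hτ, hsub, hc⟩ := hM.1.1 q hq.1
  obtain ⟨w, hw, hwn⟩ := Finset.exists_mem_notMem_of_card_lt_card (s := q.1) (t := q.2)
    (by omega)
  obtain ⟨q', hq', h1⟩ := hmatch w (hK.2 _ hτ {w} (by simpa using hw) (by simp))
  have := hmax q' (by simp [hq', h1]) (by
    rw [h1]
    exact ⟨by simpa using hw, by simp only [Finset.card_singleton]; omega⟩)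
  subst this
  simp [h1] at hwn

/-- Removing a matched pair from a Morse matching and from its complex leaves a Morse
matching. -/
theorem MorseMatching.erase {K : Finset (Finset V)} {M : Finset (Finset V × Finset V)}
    (hM : MorseMatching K M) {p : Finset V × Finset V} (hp : p ∈ M) :
    MorseMatching (K \ {p.1, p.2}) (M.erase p) := by
  refine ⟨⟨fun q hq => ?_, fun q hq q' hq' => hM.1.2 q (Finset.mem_of_mem_erase hq) q'
    (Finset.mem_of_mem_erase hq')⟩, fun ⟨n, a, b, hn, hinj, hmem, hf⟩ =>
      hM.2 ⟨n, a, b, hn, hinj, fun i hi => Finset.mem_of_mem_erase (hmem i hi), hf⟩⟩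
  obtain ⟨hne, hq⟩ := Finset.mem_erase.mp hq
  obtain ⟨h1, h2, h3⟩ := hM.1.1 q hq
  have := hM.1.2 q hq p hp
  simp only [Finset.mem_sdiff, Finset.mem_insert, Finset.mem_singleton]
  tauto

/-- A complex with a Morse matching whose only critical simplex is a vertex collapses to
that vertex. -/
theorem MorseMatching.collapses_of_critical_eq {K : Finset (Finset V)}
    {M : Finset (Finset V × Finset V)} (hK : IsComplex K) (hM : MorseMatching K M) {v : V}
    (hv : {v} ∈ K) (hcrit : IsCritical M {v})
    (huniq : ∀ σ ∈ K, IsCritical M σ → σ = {v}) : Collapses K {{v}} := by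
  induction hk : K.card using Nat.strong_induction_on generalizing K M with
  | _ k ih =>
  subst hk
  by_cases hMe : M = ∅
  · have : K = {{v}} := by
      refine Finset.eq_singleton_iff_unique_mem.mpr ⟨hv, fun σ hσ => huniq σ hσ ?_⟩
      simp [IsCritical, hMe]
    rw [this]
    exact Relation.ReflTransGen.refl
  obtain ⟨q₀, hq₀⟩ := Finset.nonempty_iff_ne_empty.mpr hMe
  obtain ⟨μ, hμK, hμ⟩ := K.exists_max_image Finset.card ⟨_, hv⟩
  have hlow : ∀ q ∈ M, q.1.card + 1 = q.2.card ∧ 1 ≤ q.1.card ∧ q.2.card ≤ μ.card := fun q hq => by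
    obtain ⟨h1, h2, -, h3⟩ := hM.1.1 q hq
    exact ⟨h3.symm, (hK.1 _ h1).card_pos, hμ _ h2⟩
  have htop : ∀ ρ ∈ K, ρ.card = μ.card → ∃ q ∈ M, q.2 = ρ := by
    intro ρ hρ hc
    have hnc : ¬ IsCritical M ρ := fun hcr => by
      have := hlow q₀ hq₀
      rw [huniq ρ hρ hcr, Finset.card_singleton] at hc
      omega
    simp only [IsCritical, not_forall, not_and_or, not_not] at hnc
    obtain ⟨q, hq, h1 | h2⟩ := hnc
    · have := hlow q hq
      rw [← h1] at this
      omega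
    · exact ⟨q, hq, h2.symm⟩
  obtain ⟨q₁, hq₁, hq₁μ⟩ := htop μ hμK rfl
  obtain ⟨q, hq, hmax⟩ := hM.exists_forall_coface_eq
    (Finset.filter_subset (fun q => q.2.card = μ.card) M) ⟨q₁, by simp [hq₁, hq₁μ]⟩
  obtain ⟨hq, hqμ⟩ := Finset.mem_filter.mp hq
  obtain ⟨hσ, hτ, hsub, hcard⟩ := hM.1.1 q hq
  have hfree : IsFreePair K q.1 q.2 := by
    refine ⟨hσ, hτ, Finset.ssubset_iff_subset_ne.mpr ⟨hsub, fun h => ?_⟩, fun ρ hρ hlt => ?_⟩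
    · rw [← h] at hcard
      omega
    · have h1 := Finset.card_lt_card hlt
      have h2 := hμ ρ hρ
      obtain ⟨q', hq', rfl⟩ := htop ρ hρ (by omega)
      rw [hmax q' (Finset.mem_filter.mpr ⟨hq', by omega⟩) ⟨hlt.subset, by omega⟩]
  refine Relation.ReflTransGen.head ⟨q.1, q.2, hfree, rfl⟩
    (ih _ (Finset.card_lt_card ?_) (hK.sdiff_freePair hfree) (hM.erase hq) ?_
      (fun q' hq' => hcrit q' (Finset.mem_of_mem_erase hq')) ?_ rfl)
  · exact Finset.ssubset_iff_subset_ne.mpr ⟨Finset.sdiff_subset, fun h => by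
      rw [← h] at hσ
      simp at hσ⟩
  · have := hcrit q hq
    simp [hv, this.1, this.2]
  · intro σ hσ' hcr
    simp only [Finset.mem_sdiff, Finset.mem_insert, Finset.mem_singleton, not_or] at hσ'
    refine huniq σ hσ'.1 fun q' hq' => ?_
    by_cases h : q' = q
    · exact h ▸ hσ'.2
    · exact hcr q' (Finset.mem_erase.mpr ⟨h, hq'⟩)

/-- A Morse matching on a nonempty complex which is not collapsible has at least two critical
simplices. -/
theorem MorseMatching.exists_critical_ne {K : Finset (Finset V)}
    {M : Finset (Finset V × Finset V)} (hK : IsComplex K) (hM : MorseMatching K M)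
    (hne : K.Nonempty) (hncol : ¬ Collapsible K) (ρ : Finset V) :
    ∃ σ ∈ K, IsCritical M σ ∧ σ ≠ ρ := by
  obtain ⟨v, hv, hcrit⟩ := hM.exists_critical_vertex hK hne
  by_contra! h
  have hρ : {v} = ρ := h _ hv hcrit
  exact hncol ⟨v, hM.collapses_of_critical_eq hK hv hcrit fun σ hσ hc => (h σ hσ hc).trans hρ.symm⟩

theorem wedgeMap_injective (p : V) (m : ℕ) (i : Fin m) : Function.Injective (wedgeMap p m i) := by
  intro v w h
  unfold wedgeMap at h
  split_ifs at h <;> simp_all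

theorem image_wedgeMap_injective (p : V) (m : ℕ) (i : Fin m) :
    Function.Injective fun σ : Finset V => σ.image (wedgeMap p m i) :=
  Finset.image_injective (wedgeMap_injective p m i)

theorem facet_image_wedgeMap {p : V} {m : ℕ} {i : Fin m} {σ τ : Finset V} :
    Facet (σ.image (wedgeMap p m i)) (τ.image (wedgeMap p m i)) ↔ Facet σ τ := by
  unfold Facet
  rw [Finset.image_subset_image_iff (wedgeMap_injective p m i),
    Finset.card_image_of_injective _ (wedgeMap_injective p m i),
    Finset.card_image_of_injective _ (wedgeMap_injective p m i)]

theorem mem_wedge {K : Finset (Finset V)} {p : V} {m : ℕ} {α : Finset (WedgeVertex V p m)} :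
    α ∈ wedge K p m ↔ ∃ i, ∃ σ ∈ K, σ.image (wedgeMap p m i) = α := by
  simp [wedge]

/-- Two copies of a complex in the wedge meet only in the basepoint. -/
theorem eq_of_image_wedgeMap_subset {p : V} {m : ℕ} {i j : Fin m} {σ τ : Finset V}
    (hσ : σ.Nonempty) (hp : σ ≠ {p})
    (h : σ.image (wedgeMap p m i) ⊆ τ.image (wedgeMap p m j)) : i = j := by
  obtain ⟨v, hv, hvp⟩ : ∃ v ∈ σ, v ≠ p := by
    by_contra! h'
    exact hp (Finset.eq_singleton_iff_nonempty_unique_mem.mpr ⟨hσ, h'⟩)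
  obtain ⟨w, -, hw⟩ := Finset.mem_image.mp (h (Finset.mem_image_of_mem _ hv))
  unfold wedgeMap at hw
  split_ifs at hw
  simp only [Option.some.injEq, Prod.mk.injEq] at hw
  exact hw.2.symm

open Classical in
/-- The restriction of a set of pairs in the wedge to its `i`-th copy of `K`. -/
noncomputable def restrictCopy (K : Finset (Finset V)) (p : V) (m : ℕ)
    (M : Finset (Finset (WedgeVertex V p m) × Finset (WedgeVertex V p m))) (i : Fin m) :
    Finset (Finset V × Finset V) :=
  (K ×ˢ K).filter fun q => (q.1.image (wedgeMap p m i), q.2.image (wedgeMap p m i)) ∈ M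

theorem mem_restrictCopy {K : Finset (Finset V)} {p : V} {m : ℕ}
    {M : Finset (Finset (WedgeVertex V p m) × Finset (WedgeVertex V p m))} {i : Fin m}
    {q : Finset V × Finset V} : q ∈ restrictCopy K p m M i ↔ (q.1 ∈ K ∧ q.2 ∈ K) ∧
      (q.1.image (wedgeMap p m i), q.2.image (wedgeMap p m i)) ∈ M := by
  simp [restrictCopy]

/-- A Morse matching on the wedge restricts to a Morse matching on each copy. -/
theorem MorseMatching.restrict {K : Finset (Finset V)} {p : V} {m : ℕ}
    {M : Finset (Finset (WedgeVertex V p m) × Finset (WedgeVertex V p m))}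
    (hM : MorseMatching (wedge K p m) M) (i : Fin m) :
    MorseMatching K (restrictCopy K p m M i) := by
  have hinj := image_wedgeMap_injective p m i
  refine ⟨⟨fun q hq => ?_, fun q hq q' hq' h => ?_⟩, ?_⟩
  · rw [mem_restrictCopy] at hq
    exact ⟨hq.1.1, hq.1.2, facet_image_wedgeMap.mp (hM.1.1 _ hq.2).2.2⟩
  · rw [mem_restrictCopy] at hq hq'
    have := hM.1.2 _ hq.2 _ hq'.2 (by
      rcases h with h | h | h | h <;> simp [h])
    rw [Prod.mk.injEq] at this
    exact Prod.ext (hinj this.1) (hinj this.2)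
  · rintro ⟨n, a, b, hn, hb, hmem, hf⟩
    exact hM.2 ⟨n, fun k => (a k).image (wedgeMap p m i), fun k => (b k).image (wedgeMap p m i), hn,
      fun k hk l hl h => hb k hk l hl (hinj h),
      fun k hk => (mem_restrictCopy.mp (hmem k hk)).2,
      fun k hk => facet_image_wedgeMap.mpr (hf k hk)⟩

/-- A matched pair whose upper simplex lies in the `i`-th copy comes from the restriction of
the matching to that copy. -/
theorem IsMatching.exists_mem_restrictCopy {K : Finset (Finset V)} {p : V} {m : ℕ}
    {M : Finset (Finset (WedgeVertex V p m) × Finset (WedgeVertex V p m))} (hK : IsComplex K)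
    (hM : IsMatching (wedge K p m) M) {q : Finset (WedgeVertex V p m) × Finset (WedgeVertex V p m)}
    (hq : q ∈ M) {i : Fin m} {τ : Finset V} (hτ : τ ∈ K) (h : τ.image (wedgeMap p m i) = q.2) :
    ∃ σ, σ.image (wedgeMap p m i) = q.1 ∧ (σ, τ) ∈ restrictCopy K p m M i := by
  obtain ⟨h1, -, hsub, -⟩ := hM.1 q hq
  rw [← h] at hsub
  obtain ⟨σ, hσ, hσq⟩ := Finset.subset_image_iff.mp hsub
  have hne : σ.Nonempty := by
    obtain ⟨j, π, hπ, h'⟩ := mem_wedge.mp h1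
    rw [← Finset.image_nonempty (f := wedgeMap p m i), hσq, ← h', Finset.image_nonempty]
    exact hK.1 π hπ
  refine ⟨σ, hσq, mem_restrictCopy.mpr ⟨⟨hK.2 τ hτ σ hσ hne, hτ⟩, ?_⟩⟩
  simpa [hσq, h] using hq

/-- A simplex of the `i`-th copy other than the basepoint is critical if it is critical for the
restriction of the matching to that copy. -/
theorem IsMatching.isCritical_image {K : Finset (Finset V)} {p : V} {m : ℕ}
    {M : Finset (Finset (WedgeVertex V p m) × Finset (WedgeVertex V p m))} (hK : IsComplex K)
    (hM : IsMatching (wedge K p m) M) {i : Fin m} {σ : Finset V} (hσ : σ ∈ K) (hp : σ ≠ {p})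
    (hcrit : IsCritical (restrictCopy K p m M i) σ) :
    IsCritical M (σ.image (wedgeMap p m i)) := by
  intro q hq
  have hinj := image_wedgeMap_injective p m i
  refine ⟨fun h => ?_, fun h => ?_⟩
  · obtain ⟨-, h2, hsub, -⟩ := hM.1 q hq
    obtain ⟨j, τ, hτ, hτq⟩ := mem_wedge.mp h2
    rw [← h, ← hτq] at hsub
    obtain rfl := eq_of_image_wedgeMap_subset (hK.1 σ hσ) hp hsub
    obtain ⟨π, hπ, hmem⟩ := hM.exists_mem_restrictCopy hK hq hτ hτq
    exact (hcrit _ hmem).1 (hinj (h.trans hπ.symm))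
  · obtain ⟨π, -, hmem⟩ := hM.exists_mem_restrictCopy hK hq hσ h
    exact (hcrit _ hmem).2 rfl

/-- Every Morse matching on the wedge of `m ≥ 1` copies of a non-collapsible complex has more
than `m` critical simplices. -/
theorem MorseMatching.lt_totalCrit_wedge {K : Finset (Finset V)} {p : V} {m : ℕ}
    {M : Finset (Finset (WedgeVertex V p m) × Finset (WedgeVertex V p m))} (hK : IsComplex K)
    (hp : {p} ∈ K) (hm : 0 < m) (hncol : ¬ Collapsible K)
    (hM : MorseMatching (wedge K p m) M) : m < totalCrit (wedge K p m) M := by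
  classical
  have hex (i : Fin m) (ρ : Finset V) :=
    (hM.restrict i).exists_critical_ne hK ⟨_, hp⟩ hncol ρ
  choose s hsK hsc hsp using fun i => hex i {p}
  set g : Fin m → Finset (WedgeVertex V p m) := fun i => (s i).image (wedgeMap p m i)
  have hginj : Function.Injective g := fun i j h =>
    eq_of_image_wedgeMap_subset (hK.1 _ (hsK i)) (hsp i) h.subset
  set D := (wedge K p m).filter (IsCritical M) with hD
  have htot : totalCrit (wedge K p m) M = D.card := by
    rw [totalCrit, ← Set.ncard_coe_finset]
    simp [hD]
  have hgD : Finset.univ.image g ⊆ D := by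
    intro α hα
    obtain ⟨i, -, rfl⟩ := Finset.mem_image.mp hα
    exact Finset.mem_filter.mpr ⟨mem_wedge.mpr ⟨i, s i, hsK i, rfl⟩,
      hM.1.isCritical_image hK (hsK i) (hsp i) (hsc i)⟩
  have hbase : ∀ i, ({p} : Finset V).image (wedgeMap p m i) = {none} := fun i => by
    simp [wedgeMap]
  obtain ⟨α, hαD, hα⟩ : ∃ α ∈ D, ∀ i, g i ≠ α := by
    by_cases hstar : IsCritical M {none}
    · refine ⟨{none}, Finset.mem_filter.mpr
        ⟨mem_wedge.mpr ⟨⟨0, hm⟩, {p}, hp, hbase _⟩, hstar⟩, fun i h => hsp i ?_⟩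
      exact image_wedgeMap_injective p m i (h.trans (hbase i).symm)
    · obtain ⟨j, hj⟩ : ∃ j, ¬ IsCritical (restrictCopy K p m M j) {p} := by
        simp only [IsCritical, not_forall] at hstar
        obtain ⟨q, hq, hqs⟩ := hstar
        obtain ⟨j, τ, hτ, hτq⟩ := mem_wedge.mp (hM.1.1 q hq).2.1
        obtain ⟨σ, hσq, hmem⟩ := hM.1.exists_mem_restrictCopy hK hq hτ hτq
        refine ⟨j, fun hcr => hqs ?_⟩
        have hinj := image_wedgeMap_injective p m j
        rw [← hσq, ← hτq, ← hbase j]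
        obtain ⟨h1, h2⟩ := hcr _ hmem
        exact ⟨hinj.ne h1, hinj.ne h2⟩
      obtain ⟨σ, hσ, hσc, hne⟩ := hex j (s j)
      have hσp : σ ≠ {p} := fun h => hj (h ▸ hσc)
      refine ⟨σ.image (wedgeMap p m j), Finset.mem_filter.mpr ⟨mem_wedge.mpr ⟨j, σ, hσ, rfl⟩,
        hM.1.isCritical_image hK hσ hσp hσc⟩, fun i h => ?_⟩
      obtain rfl := eq_of_image_wedgeMap_subset (hK.1 _ (hsK i)) (hsp i) h.subset
      exact hne (image_wedgeMap_injective p m i h).symm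
  calc m = (Finset.univ.image g).card := by simp [Finset.card_image_of_injective _ hginj]
    _ < D.card := Finset.card_lt_card
        (Finset.ssubset_iff_of_subset hgD |>.mpr ⟨α, hαD, by simpa using hα⟩)
    _ = _ := htot.symm

/-- Let `K` be a finite connected simplicial complex with `n` simplices, `p` a vertex
of `K` and `c ≥ 1`. If `K` is not collapsible, then every Morse matching on the
amplified complex `K̂_c` (the wedge of `n^(c−1)` copies of `K` at `p`) has more than
`n^(c−1)` critical simplices. -/
theorem amplified_many_critical_of_not_collapsible
    (K : Finset (Finset V)) (p : V) (c : ℕ)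
    (hK : IsComplex K) (hconn : SkeletonConnected K) (hp : ({p} : Finset V) ∈ K)
    (hc : 1 ≤ c) (hncol : ¬ Collapsible K)
    (M : Finset (Finset (WedgeVertex V p (K.card ^ (c - 1))) ×
                 Finset (WedgeVertex V p (K.card ^ (c - 1)))))
    (hM : MorseMatching (wedge K p (K.card ^ (c - 1))) M) :
    K.card ^ (c - 1) < totalCrit (wedge K p (K.card ^ (c - 1))) M := by
  exact hM.lt_totalCrit_wedge hK hp (Nat.pow_pos (Finset.card_pos.mpr ⟨_, hp⟩)) hncol
end

section
/- Let K be a finite 2-dimensional simplicial complex. If L₁ and L₂ are erasable subcomplexes of K, then L₁ ∪ L₂ is an erasable subcomplex of K. -/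
variable {V : Type*} [DecidableEq V]

/-- `L` is an erasable subcomplex of the 2-complex `K`: there is a subcomplex `C ⊆ K`
with `K ↘ C`, such that `K ∖ C ⊆ L` and the 2-simplices of `K` not in `C` are exactly
the 2-simplices of `L`. -/
def ErasableIn (K L : Finset (Finset V)) : Prop :=
  ∃ C : Finset (Finset V), IsComplex C ∧ C ⊆ K ∧ Collapses K C ∧
    (∀ σ ∈ K, σ ∉ C → σ ∈ L) ∧
    {σ : Finset V | σ ∈ K ∧ σ.card = 3 ∧ σ ∉ C} = {σ : Finset V | σ ∈ L ∧ σ.card = 3}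

/-- A collapse only removes simplices, and its result is a complex. -/
theorem Collapses.subset_and_isComplex {K K' : Finset (Finset V)} (h : Collapses K K')
    (hK : IsComplex K) : K' ⊆ K ∧ IsComplex K' := by
  induction h with
  | refl => exact ⟨subset_rfl, hK⟩
  | tail _ hstep ih =>
    obtain ⟨σ, τ, hfree, rfl⟩ := hstep
    exact ⟨Finset.sdiff_subset.trans ih.1, ih.2.sdiff_freePair hfree⟩

/-- A collapse of a 2-complex `K` restricts, on triangles, to a collapse of any complex `D ⊆ K`;
every simplex removed from `D` is a face of a simplex removed from `K`. -/
theorem Collapses.restrict_triangles {K K' D : Finset (Finset V)} (h : Collapses K K')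
    (hK : IsComplex K) (hdim : ∀ σ ∈ K, σ.card ≤ 3) (hD : IsComplex D) (hDK : D ⊆ K) :
    ∃ D', IsComplex D' ∧ D' ⊆ D ∧ Collapses D D' ∧
      (∀ σ ∈ D, σ ∉ D' → ∃ τ ∈ K, τ ∉ K' ∧ τ.card = 3 ∧ σ ⊆ τ) ∧
      ∀ σ : Finset V, σ.card = 3 → (σ ∈ D' ↔ σ ∈ D ∧ σ ∈ K') := by
  induction h with
  | refl =>
    exact ⟨D, hD, subset_rfl, .refl, fun σ h h' => absurd h h',
      fun σ _ => ⟨fun h => ⟨h, hDK h⟩, And.left⟩⟩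
  | @tail K₁ K₂ hcol hstep ih =>
    obtain ⟨D₁, hD₁, hD₁D, hcolD, hrem, htri⟩ := ih
    obtain ⟨hK₁K, hK₁⟩ := Collapses.subset_and_isComplex hcol hK
    obtain ⟨σ, τ, hfree, rfl⟩ := hstep
    have hfacet := hfree.facet hK₁
    obtain ⟨hσ, hτ, hστ, huniq⟩ := hfree
    have hτ3 := hdim τ (hK₁K hτ)
    have hrem' : ∀ ρ ∈ D, ρ ∉ D₁ →
        ∃ π ∈ K, π ∉ K₁ \ {σ, τ} ∧ π.card = 3 ∧ ρ ⊆ π := fun ρ hρ hρ' => by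
      obtain ⟨π, hπ, hπ', hρπ⟩ := hrem ρ hρ hρ'
      exact ⟨π, hπ, fun h => hπ' (Finset.mem_sdiff.1 h).1, hρπ⟩
    have hσne : ∀ ρ : Finset V, ρ.card = 3 → ρ ≠ σ := by
      rintro ρ hρ rfl
      have := hfacet.2
      omega
    by_cases hcase : τ ∈ D₁ ∧ τ.card = 3
    · obtain ⟨hτD, hτc⟩ := hcase
      have hfreeD : IsFreePair D₁ σ τ := by
        refine ⟨hD₁.2 τ hτD σ hστ.subset (hK₁.1 σ hσ), hτD, hστ, fun ρ hρ hσρ => ?_⟩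
        have h1 := hdim ρ (hDK (hD₁D hρ))
        have h2 := Finset.card_lt_card hσρ
        have h3 := hfacet.2
        exact huniq ρ ((htri ρ (by omega)).1 hρ).2 hσρ
      refine ⟨D₁ \ {σ, τ}, hD₁.sdiff_freePair hfreeD, Finset.sdiff_subset.trans hD₁D,
        hcolD.tail ⟨σ, τ, hfreeD, rfl⟩, fun ρ hρ hρ' => ?_, fun ρ hρ => ?_⟩
      · by_cases hρD : ρ ∈ D₁
        · refine ⟨τ, hK₁K hτ, by simp, hτc, ?_⟩
          have : ρ = σ ∨ ρ = τ := by simpa [hρD, or_iff_not_imp_left] using hρ'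
          rcases this with rfl | rfl
          · exact hστ.subset
          · exact subset_rfl
        · exact hrem' ρ hρ hρD
      · simp only [Finset.mem_sdiff, htri ρ hρ, and_assoc]
    · refine ⟨D₁, hD₁, hD₁D, hcolD, hrem', fun ρ hρ => ?_⟩
      have hρσ := hσne ρ hρ
      have hρτ : ρ ∈ D₁ → ρ ≠ τ := by
        rintro hρD rfl
        exact hcase ⟨hρD, hρ⟩
      have := htri ρ hρ
      simp only [Finset.mem_sdiff, Finset.mem_insert, Finset.mem_singleton]
      tauto

/-- If `L₁` and `L₂` are erasable subcomplexes of a finite 2-dimensional simplicial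
complex `K`, then so is `L₁ ∪ L₂`. -/
theorem erasableIn_union
    (K L₁ L₂ : Finset (Finset V))
    (hK : IsComplex K) (hdim : ∀ σ ∈ K, σ.card ≤ 3)
    (hL₁ : IsComplex L₁) (hL₁K : L₁ ⊆ K) (hL₂ : IsComplex L₂) (hL₂K : L₂ ⊆ K)
    (h₁ : ErasableIn K L₁) (h₂ : ErasableIn K L₂) :
    ErasableIn K (L₁ ∪ L₂) := by
  obtain ⟨C₁, hC₁, hC₁K, hcol₁, hrem₁, htri₁⟩ := h₁
  obtain ⟨C₂, -, -, hcol₂, -, htri₂⟩ := h₂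
  obtain ⟨D, hD, hDC, hcolD, hremD, htriD⟩ :=
    hcol₂.restrict_triangles hK hdim hC₁ hC₁K
  refine ⟨D, hD, hDC.trans hC₁K, hcol₁.trans hcolD, fun σ hσ hσD => ?_, ?_⟩
  · rw [Finset.mem_union]
    by_cases hσC : σ ∈ C₁
    · obtain ⟨τ, hτ, hτC, hτ3, hστ⟩ := hremD σ hσC hσD
      have hτL : τ ∈ L₂ := ((Set.ext_iff.1 htri₂ τ).1 ⟨hτ, hτ3, hτC⟩).1
      exact .inr (hL₂.2 τ hτL σ hστ (hK.1 σ hσ))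
    · exact .inl (hrem₁ σ hσ hσC)
  · ext σ
    have e₁ := Set.ext_iff.1 htri₁ σ
    have e₂ := Set.ext_iff.1 htri₂ σ
    have e := htriD σ
    simp only [Set.mem_ofPred_eq, Finset.mem_union] at e₁ e₂ ⊢
    tauto
end

section
/- Let K be a finite 2-dimensional simplicial complex that is erasable, i.e., K collapses to a complex of dimension at most 1. Then every subcomplex L ⊆ K is also erasable. -/
variable {V : Type*} [DecidableEq V]

/-- Removing a free pair from a complex leaves a complex. -/
theorem IsComplex.sdiff_of_isFreePair {L : Finset (Finset V)} {σ τ : Finset V}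
    (hL : IsComplex L) (h : IsFreePair L σ τ) : IsComplex (L \ {σ, τ}) := by
  obtain ⟨-, -, hστ, huniq⟩ := h
  refine ⟨fun ρ hρ => hL.1 ρ (Finset.mem_sdiff.1 hρ).1, fun ρ hρ π hπρ hπ => ?_⟩
  simp only [Finset.mem_sdiff, Finset.mem_insert, Finset.mem_singleton, not_or] at hρ ⊢
  obtain ⟨hρL, hρσ, hρτ⟩ := hρ
  have hσρ : ¬ σ ⊆ ρ := fun hsub =>
    hρτ (huniq ρ hρL (hsub.ssubset_of_ne (Ne.symm hρσ)))
  refine ⟨hL.2 ρ hρL π hπρ hπ, ?_, ?_⟩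
  · rintro rfl
    exact hσρ hπρ
  · rintro rfl
    exact hσρ (hστ.subset.trans hπρ)

/-- If `K` has dimension at most two and collapses to a graph, then so does every complex `L`
whose simplices of dimension at least two all belong to `K`. -/
theorem exists_collapses_of_triangles_subset {K C : Finset (Finset V)}
    (hKC : Collapses K C) (hC : ∀ σ ∈ C, σ.card ≤ 2) (hdim : ∀ σ ∈ K, σ.card ≤ 3)
    {L : Finset (Finset V)} (hL : IsComplex L) (hLK : ∀ ρ ∈ L, 3 ≤ ρ.card → ρ ∈ K) :
    ∃ D : Finset (Finset V), Collapses L D ∧ ∀ σ ∈ D, σ.card ≤ 2 := by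
  induction hKC using Relation.ReflTransGen.head_induction_on generalizing L with
  | refl =>
    refine ⟨L, Relation.ReflTransGen.refl, fun ρ hρ => ?_⟩
    by_contra hcard
    exact hcard (hC ρ (hLK ρ hρ (by omega)))
  | @head K _ hstep _ ih =>
    obtain ⟨σ, τ, ⟨-, hτK, hστ, huniq⟩, rfl⟩ := hstep
    have hdim' : ∀ ρ ∈ K \ {σ, τ}, ρ.card ≤ 3 := fun ρ hρ => hdim ρ (Finset.mem_sdiff.1 hρ).1
    have hσcard : σ.card < 3 := (Finset.card_lt_card hστ).trans_le (hdim τ hτK)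
    have hmem : ∀ ρ ∈ L, 3 ≤ ρ.card → ρ ≠ τ → ρ ∈ K \ {σ, τ} := fun ρ hρ hcard hne => by
      simp only [Finset.mem_sdiff, Finset.mem_insert, Finset.mem_singleton, not_or]
      exact ⟨hLK ρ hρ hcard, fun h => by subst h; omega, hne⟩
    by_cases hτ : τ ∈ L ∧ τ.card = 3
    · obtain ⟨hτL, hτcard⟩ := hτ
      obtain ⟨e, hσe, heτ, he⟩ := Finset.exists_subsuperset_card_eq hστ.subset
        (show σ.card ≤ 2 by omega) (show 2 ≤ τ.card by omega)
      have hfree : IsFreePair L e τ := by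
        refine ⟨hL.2 τ hτL e heτ (Finset.card_pos.1 (by omega)), hτL,
          heτ.ssubset_of_ne (fun h => by subst h; omega), fun ρ hρ heρ => ?_⟩
        have := Finset.card_lt_card heρ
        exact huniq ρ (hLK ρ hρ (by omega)) (hσe.trans_ssubset heρ)
      obtain ⟨D, hD, hDdim⟩ := ih hdim' (hL.sdiff_of_isFreePair hfree) fun ρ hρ hcard => by
        simp only [Finset.mem_sdiff, Finset.mem_insert, Finset.mem_singleton, not_or] at hρ
        exact hmem ρ hρ.1 hcard hρ.2.2
      exact ⟨D, Relation.ReflTransGen.head ⟨e, τ, hfree, rfl⟩ hD, hDdim⟩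
    · refine ih hdim' hL fun ρ hρ hcard => hmem ρ hρ hcard ?_
      rintro rfl
      exact hτ ⟨hρ, le_antisymm (hdim ρ hτK) hcard⟩

/-- If a finite 2-dimensional simplicial complex `K` is erasable (it collapses to a
complex of dimension at most 1), then every subcomplex `L ⊆ K` is erasable as well. -/
theorem erasable_of_subcomplex_of_erasable
    (K : Finset (Finset V))
    (hK : IsComplex K) (hdim : ∀ σ ∈ K, σ.card ≤ 3)
    (her : ∃ C : Finset (Finset V), Collapses K C ∧ ∀ σ ∈ C, σ.card ≤ 2)
    (L : Finset (Finset V)) (hL : IsComplex L) (hLK : L ⊆ K) :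
    ∃ C : Finset (Finset V), Collapses L C ∧ ∀ σ ∈ C, σ.card ≤ 2 := by
  obtain ⟨C, hKC, hC⟩ := her
  exact exists_collapses_of_triangles_subset hKC hC hdim hL fun ρ hρ _ => hLK hρ
end
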